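/- Let (Ω, 𝔽, P) be a probability space carrying independent real random variables F and C, where F has law N(μ_f, σ_f²) and C has law N(μ_c, σ_c²), with σ_f > 0 and σ_c > 0. Let f⁺ ∈ ℝ, α ≥ 0, v ≥ 0 and β ∈ [0, 1] be constants. Then the unified expected constrained improvement satisfies E[(1 − β)·1_{C ≥ 0}·max(f⁺ − F, 0) + β·(max(f⁺ − F, 0) + α·v − α·max(−C, 0))] = (1 − β)·Φ(μ_c/σ_c)·EI + β·(EI + α·v + α·μ_c·Φ(Z_c) − α·σ_c·φ(Z_c)), where EI = (f⁺ − μ_f)·Φ(Z_f) + σ_f·φ(Z_f), Z_f = (f⁺ − μ_f)/σ_f and Z_c = −μ_c/σ_c. That is, EI_{UC} = (1 − β)·PF·EI + β·EI_{M,1} in closed form. -/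

import Mathlib

open MeasureTheory ProbabilityTheory Real

/-- The density of the standard normal distribution on `ℝ`. -/
noncomputable def stdNormalPDF (z : ℝ) : ℝ :=
  (Real.sqrt (2 * Real.pi))⁻¹ * Real.exp (-z ^ 2 / 2)

/-- The cumulative distribution function of the standard normal distribution. -/
noncomputable def stdNormalCDF (t : ℝ) : ℝ :=
  ∫ z in Set.Iic t, stdNormalPDF z

lemma stdNormalPDF_eq_gaussianPDFReal : stdNormalPDF = gaussianPDFReal 0 1 := by
  ext z
  simp [stdNormalPDF, gaussianPDFReal]

lemma gaussianReal_eq_map_standard (μ σ : ℝ) :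
    gaussianReal μ (⟨σ ^ 2, sq_nonneg σ⟩ : NNReal)
      = (gaussianReal 0 1).map (fun z => μ + σ * z) := by
  have h : (fun z : ℝ => μ + σ * z) = (fun x => μ + x) ∘ (fun z => σ * z) := rfl
  rw [h, ← Measure.map_map (by fun_prop) (by fun_prop), gaussianReal_map_const_mul,
    gaussianReal_map_const_add]
  simp only [mul_zero, zero_add, mul_one]
  rfl

lemma gaussianReal_standard_real_Iic (t : ℝ) :
    (gaussianReal 0 1).real (Set.Iic t) = stdNormalCDF t := by
  rw [measureReal_def, gaussianReal_apply_eq_integral _ one_ne_zero,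
    ENNReal.toReal_ofReal (integral_nonneg fun x => gaussianPDFReal_nonneg 0 1 x), stdNormalCDF,
    stdNormalPDF_eq_gaussianPDFReal]

/-- The probability of feasibility: the mass a Gaussian law gives to the nonnegative reals. -/
lemma gaussianReal_real_Ici_zero (μ : ℝ) {σ : ℝ} (hσ : 0 < σ) :
    (gaussianReal μ (⟨σ ^ 2, sq_nonneg σ⟩ : NNReal)).real (Set.Ici 0)
      = stdNormalCDF (μ / σ) := by
  have hneg : gaussianReal 0 1 = (gaussianReal 0 1).map (fun x => -x) := by
    rw [gaussianReal_map_neg, neg_zero]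
  rw [gaussianReal_eq_map_standard, hneg, Measure.map_map (by fun_prop) (by fun_prop),
    map_measureReal_apply (by fun_prop) measurableSet_Ici, ← gaussianReal_standard_real_Iic]
  congr 1
  ext z
  simp only [Set.mem_preimage, Function.comp_apply, Set.mem_Ici, Set.mem_Iic, le_div_iff₀ hσ]
  constructor <;> intro h <;> linarith

lemma hasDerivAt_stdNormalPDF (z : ℝ) :
    HasDerivAt stdNormalPDF (-z * stdNormalPDF z) z := by
  have h : HasDerivAt (fun x : ℝ => -x ^ 2 / 2) (-z) z :=
    ((hasDerivAt_pow 2 z).neg.div_const 2).congr_deriv (by norm_num; ring)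
  refine (h.exp.const_mul (Real.sqrt (2 * Real.pi))⁻¹).congr_deriv ?_
  rw [stdNormalPDF]
  ring

lemma integrable_stdNormalPDF : Integrable stdNormalPDF := by
  rw [stdNormalPDF_eq_gaussianPDFReal]
  exact integrable_gaussianPDFReal 0 1

lemma integrable_neg_mul_stdNormalPDF : Integrable (fun z => -z * stdNormalPDF z) := by
  have h := (integrable_mul_exp_neg_mul_sq (b := 1 / 2) (by norm_num)).const_mul
    (-(Real.sqrt (2 * Real.pi))⁻¹)
  refine h.congr (ae_of_all _ fun z => ?_)
  simp only [stdNormalPDF]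
  rw [show -(1 / 2 : ℝ) * z ^ 2 = -z ^ 2 / 2 by ring]
  ring

lemma tendsto_stdNormalPDF_atBot :
    Filter.Tendsto stdNormalPDF Filter.atBot (nhds 0) :=
  tendsto_zero_of_hasDerivAt_of_integrableOn_Iic (a := 0)
    (fun x _ => hasDerivAt_stdNormalPDF x) integrable_neg_mul_stdNormalPDF.integrableOn
    integrable_stdNormalPDF.integrableOn

lemma integral_Iic_neg_mul_stdNormalPDF (t : ℝ) :
    ∫ z in Set.Iic t, -z * stdNormalPDF z = stdNormalPDF t := by
  rw [integral_Iic_of_hasDerivAt_of_tendsto' (fun x _ => hasDerivAt_stdNormalPDF x)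
    integrable_neg_mul_stdNormalPDF.integrableOn tendsto_stdNormalPDF_atBot, sub_zero]

lemma integral_max_sub_gaussianReal_standard (t : ℝ) :
    ∫ z, max (t - z) 0 ∂(gaussianReal 0 1) = t * stdNormalCDF t + stdNormalPDF t := by
  have hind : ∀ z, gaussianPDFReal 0 1 z • max (t - z) 0
      = (Set.Iic t).indicator (fun z => t * stdNormalPDF z + -z * stdNormalPDF z) z := by
    intro z
    rw [← stdNormalPDF_eq_gaussianPDFReal, smul_eq_mul]
    by_cases hz : z ≤ t
    · rw [Set.indicator_of_mem (Set.mem_Iic.2 hz), max_eq_left (sub_nonneg.2 hz)]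
      ring
    · rw [Set.indicator_of_notMem (by simpa using hz), max_eq_right (by linarith), mul_zero]
  rw [integral_gaussianReal_eq_integral_smul one_ne_zero, integral_congr_ae (ae_of_all _ hind),
    integral_indicator measurableSet_Iic,
    integral_add (integrable_stdNormalPDF.const_mul t).integrableOn
      integrable_neg_mul_stdNormalPDF.integrableOn,
    integral_const_mul, integral_Iic_neg_mul_stdNormalPDF, stdNormalCDF]

/-- The classical closed form of expected improvement under a Gaussian law. -/
lemma integral_max_sub_gaussianReal (k μ : ℝ) {σ : ℝ} (hσ : 0 < σ) :
    ∫ x, max (k - x) 0 ∂(gaussianReal μ (⟨σ ^ 2, sq_nonneg σ⟩ : NNReal))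
      = (k - μ) * stdNormalCDF ((k - μ) / σ) + σ * stdNormalPDF ((k - μ) / σ) := by
  have hscale : ∀ z, max (k - (μ + σ * z)) 0 = σ * max ((k - μ) / σ - z) 0 := by
    intro z
    rw [mul_max_of_nonneg _ _ hσ.le, mul_zero, mul_sub, mul_div_cancel₀ _ hσ.ne']
    ring_nf
  rw [gaussianReal_eq_map_standard, integral_map (by fun_prop) (by fun_prop)]
  simp only [hscale]
  rw [integral_const_mul, integral_max_sub_gaussianReal_standard]
  field_simp

lemma integrable_max_sub_gaussianReal (k μ : ℝ) (v : NNReal) :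
    Integrable (fun x => max (k - x) 0) (gaussianReal μ v) :=
  ((integrable_const k).sub ((memLp_id_gaussianReal 1).integrable le_rfl)).pos_part

/-- Closed form of the unified expected constrained improvement:
`EI_UC = (1 - β)·PF·EI + β·EI_{M,1}`. -/
theorem unified_expected_constrained_improvement_closed_form
    {Ω : Type*} [MeasurableSpace Ω] (P : Measure Ω) [IsProbabilityMeasure P]
    (F C : Ω → ℝ) (hF : Measurable F) (hC : Measurable C)
    (hindep : IndepFun F C P)
    (μf σf μc σc : ℝ) (hσf : 0 < σf) (hσc : 0 < σc)
    (hlawF : P.map F = gaussianReal μf (⟨σf ^ 2, sq_nonneg σf⟩ : NNReal))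
    (hlawC : P.map C = gaussianReal μc (⟨σc ^ 2, sq_nonneg σc⟩ : NNReal))
    (fplus α v β : ℝ) (hα : 0 ≤ α) (hv : 0 ≤ v) (hβ0 : 0 ≤ β) (hβ1 : β ≤ 1) :
    ∫ ω, ((1 - β) * {ω | 0 ≤ C ω}.indicator (fun ω => max (fplus - F ω) 0) ω
        + β * (max (fplus - F ω) 0 + α * v - α * max (-C ω) 0)) ∂P =
      (1 - β) * stdNormalCDF (μc / σc) *
        ((fplus - μf) * stdNormalCDF ((fplus - μf) / σf)
          + σf * stdNormalPDF ((fplus - μf) / σf))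
      + β * (((fplus - μf) * stdNormalCDF ((fplus - μf) / σf)
          + σf * stdNormalPDF ((fplus - μf) / σf))
        + α * v
        + α * μc * stdNormalCDF (-μc / σc) - α * σc * stdNormalPDF (-μc / σc)) := by
  have hEI : ∫ ω, max (fplus - F ω) 0 ∂P = (fplus - μf) * stdNormalCDF ((fplus - μf) / σf)
      + σf * stdNormalPDF ((fplus - μf) / σf) := by
    rw [← integral_max_sub_gaussianReal fplus μf hσf, ← hlawF,
      integral_map hF.aemeasurable (by fun_prop)]
  have hviol : ∫ ω, max (-C ω) 0 ∂P = -μc * stdNormalCDF (-μc / σc)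
      + σc * stdNormalPDF (-μc / σc) := by
    have h := integral_max_sub_gaussianReal 0 μc hσc
    rw [← hlawC, integral_map hC.aemeasurable (by fun_prop)] at h
    simpa only [zero_sub] using h
  have hintF : Integrable (fun ω => max (fplus - F ω) 0) P := by
    have h := integrable_max_sub_gaussianReal fplus μf ⟨σf ^ 2, sq_nonneg σf⟩
    rw [← hlawF] at h
    exact h.comp_measurable hF
  have hintC : Integrable (fun ω => max (-C ω) 0) P := by
    have h := integrable_max_sub_gaussianReal 0 μc ⟨σc ^ 2, sq_nonneg σc⟩
    rw [← hlawC] at h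
    simpa only [Function.comp_def, zero_sub] using h.comp_measurable hC
  have hfeas : MeasurableSet {ω | 0 ≤ C ω} := measurableSet_le measurable_const hC
  have hPF : ∫ ω, {ω | 0 ≤ C ω}.indicator (fun _ => (1 : ℝ)) ω ∂P = stdNormalCDF (μc / σc) := by
    rw [integral_indicator_const _ hfeas, ← gaussianReal_real_Ici_zero μc hσc, ← hlawC,
      map_measureReal_apply hC measurableSet_Ici, smul_eq_mul, mul_one]
    rfl
  have hindep' : IndepFun (fun ω => {ω | 0 ≤ C ω}.indicator (fun _ => (1 : ℝ)) ω)
      (fun ω => max (fplus - F ω) 0) P :=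
    hindep.symm.comp (φ := (Set.Ici (0 : ℝ)).indicator fun _ => (1 : ℝ))
      (ψ := fun x => max (fplus - x) 0)
      (measurable_const.indicator measurableSet_Ici) (by fun_prop)
  have hECI : ∫ ω, {ω | 0 ≤ C ω}.indicator (fun ω => max (fplus - F ω) 0) ω ∂P
      = stdNormalCDF (μc / σc) * ∫ ω, max (fplus - F ω) 0 ∂P := by
    rw [← hPF, ← hindep'.integral_fun_mul_eq_mul_integral
      (measurable_const.indicator hfeas).aestronglyMeasurable hintF.aestronglyMeasurable]
    refine integral_congr_ae (ae_of_all _ fun ω => ?_)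
    by_cases hω : 0 ≤ C ω <;> simp [Set.indicator, hω]
  have hmerit : Integrable (fun ω => max (fplus - F ω) 0 + α * v) P :=
    hintF.add (integrable_const _)
  have hmerit_sub : Integrable (fun ω => max (fplus - F ω) 0 + α * v - α * max (-C ω) 0) P :=
    hmerit.sub (hintC.const_mul α)
  rw [integral_add ((hintF.indicator hfeas).const_mul _) (hmerit_sub.const_mul β),
    integral_const_mul, integral_const_mul, integral_sub hmerit (hintC.const_mul α),
    integral_add hintF (integrable_const _), integral_const, integral_const_mul, hECI, hEI, hviol,
    probReal_univ, smul_eq_mul]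
  ring
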